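/- arXiv:2604.04752 — 4 statements merged into one kernel-verified Lean document; each statement's English description precedes it below -/
import Mathlib

section
/- Let G be a directed graph with positive integer edge lengths, let 0 < ε, let h ≥ 1 and λ ≥ 1 be integers, and let D be an h-length (1+ε)-distance-preserving DAG projection onto G with map π. Let D' be the graph induced from λ disjoint copies of D. Then: (1) D' is acyclic; (2) every directed path in D' projects to a directed walk in G of the same length, so dist_G(s,t) ≤ dist_{D'}(π⁻¹(s), π⁻¹(t)) for all s,t ∈ V(G); and (3) for every pair s,t ∈ V(G) such that some shortest s–t path in G can be written as a concatenation of at most λ consecutive subpaths each of length at most h, we have dist_{D'}(π⁻¹(s), π⁻¹(t)) ≤ (1+ε)·dist_G(s,t). -/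
open scoped Classical ENNReal

/-- `IsWalk E s t l`: `l` is the list of successive vertices (after `s`) of a
directed walk from `s` to `t` in the graph with edge relation `E`. -/
def IsWalk {V : Type*} (E : V → V → Prop) : V → V → List V → Prop
  | s, t, [] => s = t
  | s, t, v :: rest => E s v ∧ IsWalk E v t rest

/-- Total length of the walk starting at `s` with successive vertices `l`. -/
def walkLen {V : Type*} (ℓ : V → V → ℕ) : V → List V → ℕ
  | _, [] => 0
  | s, v :: rest => ℓ s v + walkLen ℓ v rest

/-- Shortest-path distance from `s` to `t` (`∞` if `t` is unreachable from `s`). -/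
noncomputable def gdist {V : Type*} (E : V → V → Prop) (ℓ : V → V → ℕ) (s t : V) : ℝ≥0∞ :=
  ⨅ (l : List V) (_ : IsWalk E s t l), (walkLen ℓ s l : ℝ≥0∞)

/-- Set-to-set shortest-path distance. -/
noncomputable def gdistSet {V : Type*} (E : V → V → Prop) (ℓ : V → V → ℕ)
    (A B : Set V) : ℝ≥0∞ :=
  ⨅ (a ∈ A) (b ∈ B), gdist E ℓ a b

/-- A directed graph is acyclic (a DAG). -/
def IsDag {V : Type*} (E : V → V → Prop) : Prop := ∀ x : V, ¬ Relation.TransGen E x x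


/-- `SplitWalk E ℓ h r s t l`: the walk `l` from `s` to `t` can be written as a
concatenation of (at most) `r` consecutive subwalks, each of length at most `h`. -/
def SplitWalk {V : Type*} (E : V → V → Prop) (ℓ : V → V → ℕ) (h : ℕ) :
    ℕ → V → V → List V → Prop
  | 0, s, t, l => s = t ∧ l = []
  | r + 1, s, t, l => ∃ (l₁ l₂ : List V) (mid : V), l = l₁ ++ l₂ ∧
      IsWalk E s mid l₁ ∧ walkLen ℓ s l₁ ≤ h ∧ SplitWalk E ℓ h r mid t l₂

theorem isWalk_append {V : Type*} (E : V → V → Prop) :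
    ∀ (l₁ l₂ : List V) (s m t : V), IsWalk E s m l₁ → IsWalk E m t l₂ → IsWalk E s t (l₁ ++ l₂)
  | [], l₂, s, m, t, h1, h2 => by
      simp only [IsWalk] at h1
      subst h1
      exact h2
  | v :: l₁, l₂, s, m, t, h1, h2 => by
      simp only [IsWalk, List.cons_append] at h1 ⊢
      exact ⟨h1.1, isWalk_append E l₁ l₂ v m t h1.2 h2⟩

theorem walkLen_append {V : Type*} (E : V → V → Prop) (ℓ : V → V → ℕ) :
    ∀ (l₁ l₂ : List V) (s m : V), IsWalk E s m l₁ →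
      walkLen ℓ s (l₁ ++ l₂) = walkLen ℓ s l₁ + walkLen ℓ m l₂
  | [], l₂, s, m, h1 => by
      simp only [IsWalk] at h1
      subst h1
      simp [walkLen]
  | v :: l₁, l₂, s, m, h1 => by
      simp only [IsWalk, List.cons_append, walkLen] at h1 ⊢
      rw [walkLen_append E ℓ l₁ l₂ v m h1.2]
      omega

theorem gdist_le {V : Type*} (E : V → V → Prop) (ℓ : V → V → ℕ) (s t : V) (l : List V)
    (hl : IsWalk E s t l) : gdist E ℓ s t ≤ (walkLen ℓ s l : ℝ≥0∞) :=
  iInf₂_le l hl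

theorem exists_walk_le {V : Type*} (E : V → V → Prop) (ℓ : V → V → ℕ) (A B : Set V)
    (c : ℝ≥0∞) (hc : c ≠ ⊤) (h : gdistSet E ℓ A B ≤ c) :
    ∃ a ∈ A, ∃ b ∈ B, ∃ l, IsWalk E a b l ∧ (walkLen ℓ a l : ℝ≥0∞) ≤ c := by
  by_cases hex : ∃ n : ℕ, ∃ a ∈ A, ∃ b ∈ B, ∃ l, IsWalk E a b l ∧ walkLen ℓ a l = n
  · obtain ⟨a, ha, b, hb, l, hl, hn⟩ := Nat.find_spec hex
    refine ⟨a, ha, b, hb, l, hl, le_trans ?_ h⟩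
    rw [hn]
    refine le_iInf₂ fun a' ha' => le_iInf₂ fun b' hb' => le_iInf₂ fun l' hl' => ?_
    exact_mod_cast Nat.find_min' hex ⟨a', ha', b', hb', l', hl', rfl⟩
  · exfalso
    apply hc
    rw [← top_le_iff]
    refine le_trans ?_ h
    refine le_iInf₂ fun a' ha' => le_iInf₂ fun b' hb' => le_iInf₂ fun l' hl' => ?_
    exact absurd ⟨_, a', ha', b', hb', l', hl', rfl⟩ hex

theorem lift_walk {VD : Type*} {lam : ℕ} (ED : VD → VD → Prop) (ℓD : VD → VD → ℕ)
    (ED' : VD × Fin lam → VD × Fin lam → Prop) (ℓD' : VD × Fin lam → VD × Fin lam → ℕ)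
    (k : Fin lam) (h1 : ∀ x y, ED x y → ED' (x, k) (y, k))
    (h2 : ∀ x y, ℓD' (x, k) (y, k) = ℓD x y) :
    ∀ (l : List VD) (a b : VD), IsWalk ED a b l →
      IsWalk ED' (a, k) (b, k) (l.map fun x => (x, k)) ∧
      walkLen ℓD' (a, k) (l.map fun x => (x, k)) = walkLen ℓD a l
  | [], a, b, h => by
      simp only [IsWalk] at h
      subst h
      simp [IsWalk, walkLen]
  | v :: l, a, b, h => by
      simp only [IsWalk] at h
      have ih := lift_walk ED ℓD ED' ℓD' k h1 h2 l v b h.2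
      simp only [List.map_cons, IsWalk, walkLen, h2, ih.2, and_true]
      exact ⟨h1 _ _ h.1, ih.1⟩

/-- Let `D` be an `h`-length `(1+ε)`-distance-preserving DAG
projection onto `G`, and let `D'` be the graph induced from `λ` disjoint copies
of `D`. Then `D'` is acyclic; every directed path of `D'` projects to a directed
walk of `G` of the same length (so `dist_G(s,t) ≤ dist_{D'}(π⁻¹(s),π⁻¹(t))`);
and for every pair `s,t` such that some shortest `s`–`t` path of `G`
decomposes into at most `λ` consecutive subpaths of length at most `h` each,
`dist_{D'}(π⁻¹(s),π⁻¹(t)) ≤ (1+ε)·dist_G(s,t)`. -/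
theorem statement2 {VG VD : Type*} [Fintype VG] [Fintype VD]
    (EG : VG → VG → Prop) (ℓG : VG → VG → ℕ)
    (hpos : ∀ u v, EG u v → 0 < ℓG u v)
    (ε : ℝ) (hε : 0 < ε)
    (h lam : ℕ) (hh : 1 ≤ h) (hlam : 1 ≤ lam)
    (ED : VD → VD → Prop) (ℓD : VD → VD → ℕ) (π : VD → VG)
    (hdag : IsDag ED)
    (hhom : ∀ x y, ED x y → EG (π x) (π y) ∧ ℓD x y = ℓG (π x) (π y))
    (hlow : ∀ s t : VG, gdist EG ℓG s t ≤ gdistSet ED ℓD (π ⁻¹' {s}) (π ⁻¹' {t}))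
    (hup : ∀ s t : VG, gdist EG ℓG s t ≤ (h : ℝ≥0∞) →
      gdistSet ED ℓD (π ⁻¹' {s}) (π ⁻¹' {t}) ≤ (1 + ENNReal.ofReal ε) * gdist EG ℓG s t)
    (ED' : VD × Fin lam → VD × Fin lam → Prop)
    (hED' : ∀ a b, ED' a b ↔
      ((a.2 = b.2 ∧ ED a.1 b.1) ∨ (a.2 < b.2 ∧ (π a.1 = π b.1 ∨ EG (π a.1) (π b.1)))))
    (ℓD' : VD × Fin lam → VD × Fin lam → ℕ)
    (hℓD' : ∀ a b, ℓD' a b =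
      if a.2 = b.2 then ℓD a.1 b.1
      else if π a.1 = π b.1 then 0 else ℓG (π a.1) (π b.1)) :
    IsDag ED' ∧
    (∀ (a b : VD × Fin lam) (l' : List (VD × Fin lam)), IsWalk ED' a b l' →
      ∃ lG : List VG, IsWalk EG (π a.1) (π b.1) lG ∧
        walkLen ℓG (π a.1) lG = walkLen ℓD' a l') ∧
    (∀ s t : VG, gdist EG ℓG s t ≤
      gdistSet ED' ℓD' ((fun a : VD × Fin lam => π a.1) ⁻¹' {s})
        ((fun a : VD × Fin lam => π a.1) ⁻¹' {t})) ∧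
    (∀ s t : VG,
      (∃ l : List VG, IsWalk EG s t l ∧ (walkLen ℓG s l : ℝ≥0∞) = gdist EG ℓG s t ∧
        SplitWalk EG ℓG h lam s t l) →
      gdistSet ED' ℓD' ((fun a : VD × Fin lam => π a.1) ⁻¹' {s})
          ((fun a : VD × Fin lam => π a.1) ⁻¹' {t}) ≤
        (1 + ENNReal.ofReal ε) * gdist EG ℓG s t) := by
  have hproj : ∀ (l' : List (VD × Fin lam)) (a b : VD × Fin lam), IsWalk ED' a b l' →
      ∃ lG : List VG, IsWalk EG (π a.1) (π b.1) lG ∧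
        walkLen ℓG (π a.1) lG = walkLen ℓD' a l' := by
    intro l'
    induction l' with
    | nil =>
      intro a b hw
      simp only [IsWalk] at hw
      subst hw
      exact ⟨[], rfl, rfl⟩
    | cons v l' ih =>
      intro a b hw
      simp only [IsWalk] at hw
      obtain ⟨lG, h1, h2⟩ := ih v b hw.2
      have hl := hℓD' a v
      rcases (hED' a v).1 hw.1 with ⟨he, hE⟩ | ⟨hlt, hE⟩
      · refine ⟨π v.1 :: lG, ⟨(hhom _ _ hE).1, h1⟩, ?_⟩
        simp only [walkLen, h2, hl, if_pos he, (hhom _ _ hE).2]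
      · rw [if_neg hlt.ne] at hl
        by_cases hp : π a.1 = π v.1
        · rw [if_pos hp] at hl
          refine ⟨lG, by rw [hp]; exact h1, ?_⟩
          rw [hp, h2]
          simp only [walkLen, hl, zero_add]
        · rw [if_neg hp] at hl
          refine ⟨π v.1 :: lG, ⟨hE.resolve_left hp, h1⟩, ?_⟩
          simp only [walkLen, h2, hl]
  refine ⟨?_, fun a b l' => hproj l' a b, ?_, ?_⟩
  · intro x hx
    have key : ∀ y, Relation.TransGen ED' x y →
        (x.2 = y.2 ∧ Relation.TransGen ED x.1 y.1) ∨ x.2 < y.2 := by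
      intro y hy
      induction hy with
      | single hb =>
        rcases (hED' _ _).1 hb with ⟨he, hE⟩ | ⟨hlt, _⟩
        · exact Or.inl ⟨he, .single hE⟩
        · exact Or.inr hlt
      | tail _ hb ih =>
        rcases (hED' _ _).1 hb with ⟨he, hE⟩ | ⟨hlt, _⟩
        · rcases ih with ⟨he', hT⟩ | hlt'
          · exact Or.inl ⟨he'.trans he, hT.tail hE⟩
          · exact Or.inr (he ▸ hlt')
        · rcases ih with ⟨he', hT⟩ | hlt'
          · exact Or.inr (he' ▸ hlt)
          · exact Or.inr (hlt'.trans hlt)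
    rcases key x hx with ⟨_, hT⟩ | hlt
    · exact hdag _ hT
    · exact lt_irrefl _ hlt
  · intro s t
    refine le_iInf₂ fun a ha => le_iInf₂ fun b hb => le_iInf₂ fun l hl => ?_
    obtain ⟨lG, h1, h2⟩ := hproj l a b hl
    simp only [Set.mem_preimage, Set.mem_singleton_iff] at ha hb
    rw [← h2]
    subst ha hb
    exact gdist_le _ _ _ _ _ h1
  · have hctop : (1 + ENNReal.ofReal ε) ≠ ⊤ := by simp
    have piece : ∀ (k : Fin lam) (s m : VG) (l : List VG), IsWalk EG s m l →
        walkLen ℓG s l ≤ h → ∃ a b : VD, π a = s ∧ π b = m ∧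
          ∃ l', IsWalk ED' (a, k) (b, k) l' ∧
            (walkLen ℓD' (a, k) l' : ℝ≥0∞) ≤ (1 + ENNReal.ofReal ε) * (walkLen ℓG s l : ℝ≥0∞) := by
      intro k s m l hl hle
      have hg := gdist_le EG ℓG s m l hl
      have hg' : gdist EG ℓG s m ≤ (h : ℝ≥0∞) := hg.trans (by exact_mod_cast hle)
      have hu := (hup s m hg').trans (mul_le_mul_right hg _)
      obtain ⟨a, ha, b, hb, l', hl', hlen⟩ := exists_walk_le ED ℓD _ _ _
        (ENNReal.mul_ne_top hctop (ENNReal.natCast_ne_top _)) hu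
      obtain ⟨hw, hL⟩ := lift_walk ED ℓD ED' ℓD' k
        (fun x y hxy => (hED' _ _).2 (Or.inl ⟨rfl, hxy⟩)) (fun x y => by simp [hℓD']) l' a b hl'
      exact ⟨a, b, ha, hb, _, hw, by rw [hL]; exact hlen⟩
    have main : ∀ (r k : ℕ) (hk : k < lam), k + (r + 1) ≤ lam → ∀ (s t : VG) (l : List VG),
        SplitWalk EG ℓG h (r + 1) s t l → ∃ (a : VD) (b : VD × Fin lam), π a = s ∧ π b.1 = t ∧
          ∃ l', IsWalk ED' (a, ⟨k, hk⟩) b l' ∧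
            (walkLen ℓD' (a, ⟨k, hk⟩) l' : ℝ≥0∞) ≤
              (1 + ENNReal.ofReal ε) * (walkLen ℓG s l : ℝ≥0∞) := by
      intro r
      induction r with
      | zero =>
        intro k hk _ s t l hs
        obtain ⟨l₁, l₂, m, rfl, hw, hle, hmt, hl2⟩ := hs
        subst hmt hl2
        rw [List.append_nil]
        obtain ⟨a, b, ha, hb, hr⟩ := piece ⟨k, hk⟩ s m l₁ hw hle
        exact ⟨a, (b, ⟨k, hk⟩), ha, hb, hr⟩
      | succ r ih =>
        intro k hk hkr s t l hs
        obtain ⟨l₁, l₂, m, rfl, hw, hle, hs2⟩ := hs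
        obtain ⟨a, b, ha, hb, l1', hw1, hL1⟩ := piece ⟨k, hk⟩ s m l₁ hw hle
        obtain ⟨a', b', ha', hb', l2', hw2, hL2⟩ :=
          ih (k + 1) (by omega) (by omega) m t l₂ hs2
        have hlt : (⟨k, hk⟩ : Fin lam) < ⟨k + 1, by omega⟩ := by
          simp [Fin.lt_def]
        have hpp : π b = π a' := by rw [hb, ha']
        have hw3 : IsWalk ED' (b, ⟨k, hk⟩) b' ((a', ⟨k + 1, by omega⟩) :: l2') :=
          ⟨(hED' _ _).2 (Or.inr ⟨hlt, Or.inl hpp⟩), hw2⟩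
        refine ⟨a, b', ha, hb', l1' ++ (a', ⟨k + 1, by omega⟩) :: l2',
          isWalk_append ED' _ _ _ _ _ hw1 hw3, ?_⟩
        rw [walkLen_append ED' ℓD' _ _ _ _ hw1, walkLen_append EG ℓG _ _ _ _ hw]
        have h0 : ℓD' (b, ⟨k, hk⟩) (a', ⟨k + 1, by omega⟩) = 0 := by
          rw [hℓD', if_neg hlt.ne, if_pos hpp]
        simp only [walkLen, h0, zero_add]
        push_cast
        rw [mul_add]
        exact add_le_add hL1 hL2
    rintro s t ⟨l, _, hlen, hs⟩
    obtain ⟨r, rfl⟩ : ∃ r, lam = r + 1 := ⟨lam - 1, by omega⟩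
    obtain ⟨a, b, ha, hb, l', hw, hL⟩ := main r 0 (by omega) (by omega) s t l hs
    rw [← hlen]
    refine le_trans ?_ hL
    refine (iInf₂_le (a, ⟨0, by omega⟩) ha).trans ((iInf₂_le b hb).trans ?_)
    exact gdist_le _ _ _ _ _ hw
end

section
/- Let G be a directed graph with positive integer edge lengths, let 0 < ε ≤ 1, and let D be a (1+ε)-distance-preserving DAG projection onto G with map π. Let H^D be a (β,ε)-hopset of D. Define H := {(π(u), π(v)) : (u,v) ∈ H^D} with lengths ℓ_H(a,b) := min{ℓ_{H^D}(u,v) : (u,v) ∈ H^D, π(u)=a, π(v)=b}. Then H is a (β, 3ε)-hopset of G; that is, ℓ_H(a,b) ≥ dist_G(a,b) for every (a,b) ∈ H, and for all s,t ∈ V(G), dist^{(β)}_{G∪H}(s,t) ≤ (1+3ε)·dist_G(s,t). -/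
open scoped Classical ENNReal

/-- Edge relation of `G ∪ H`. -/
def unionEdge {V : Type*} (E H : V → V → Prop) (u v : V) : Prop := E u v ∨ H u v

/-- Edge lengths of `G ∪ H` (parallel edges are resolved by taking the minimum,
which is what matters for shortest paths). -/
noncomputable def unionLen {V : Type*} (E H : V → V → Prop) (ℓE ℓH : V → V → ℕ)
    (u v : V) : ℕ :=
  if E u v then (if H u v then min (ℓE u v) (ℓH u v) else ℓE u v) else ℓH u v

/-- `β`-hop-bounded shortest-path distance: minimum length over directed walks
using at most `β` edges. -/
noncomputable def gdistHop {V : Type*} (E : V → V → Prop) (ℓ : V → V → ℕ) (β : ℕ)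
    (s t : V) : ℝ≥0∞ :=
  ⨅ (l : List V) (_ : IsWalk E s t l ∧ l.length ≤ β), (walkLen ℓ s l : ℝ≥0∞)

theorem walk_map_len {V W : Type*} (E : V → V → Prop) (E' : W → W → Prop)
    (l₁ : V → V → ℕ) (l₂ : W → W → ℕ) (p : V → W)
    (h : ∀ x y, E x y → E' (p x) (p y) ∧ l₂ (p x) (p y) ≤ l₁ x y)
    (t : V) (l : List V) : ∀ s, IsWalk E s t l →
      IsWalk E' (p s) (p t) (l.map p) ∧ walkLen l₂ (p s) (l.map p) ≤ walkLen l₁ s l := by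
  induction l with
  | nil =>
    intro s hs
    simp only [IsWalk] at hs
    subst hs
    simp [IsWalk, walkLen]
  | cons v r ih =>
    intro s hs
    obtain ⟨h1, h2⟩ := hs
    obtain ⟨h3, h4⟩ := ih v h2
    obtain ⟨h5, h6⟩ := h s v h1
    exact ⟨⟨h5, h3⟩, Nat.add_le_add h6 h4⟩

/-- If `D` is a `(1+ε)`-distance-preserving DAG projection onto
`G` and `H^D` is a `(β,ε)`-hopset of `D`, then the projected edge set
`H = π(H^D)` with lengths `ℓ_H(a,b) = min{ℓ_{H^D}(u,v) : π(u)=a, π(v)=b}`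
is a `(β,3ε)`-hopset of `G`. -/
theorem statement3 {VG VD : Type*} [Fintype VG] [Fintype VD]
    (EG : VG → VG → Prop) (ℓG : VG → VG → ℕ)
    (hpos : ∀ u v, EG u v → 0 < ℓG u v)
    (ε : ℝ) (hε0 : 0 < ε) (hε1 : ε ≤ 1)
    (ED : VD → VD → Prop) (ℓD : VD → VD → ℕ) (π : VD → VG)
    (hdag : IsDag ED)
    (hhom : ∀ x y, ED x y → EG (π x) (π y) ∧ ℓD x y = ℓG (π x) (π y))
    (hlow : ∀ s t : VG, gdist EG ℓG s t ≤ gdistSet ED ℓD (π ⁻¹' {s}) (π ⁻¹' {t}))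
    (hup : ∀ s t : VG, gdistSet ED ℓD (π ⁻¹' {s}) (π ⁻¹' {t}) ≤
      (1 + ENNReal.ofReal ε) * gdist EG ℓG s t)
    (β : ℕ) (HD : VD → VD → Prop) (ℓHD : VD → VD → ℕ)
    (hHD1 : ∀ u v, HD u v → gdist ED ℓD u v ≤ (ℓHD u v : ℝ≥0∞))
    (hHD2 : ∀ s t : VD,
      gdistHop (unionEdge ED HD) (unionLen ED HD ℓD ℓHD) β s t ≤
        (1 + ENNReal.ofReal ε) * gdist ED ℓD s t)
    (EH : VG → VG → Prop)
    (hEH : ∀ a b, EH a b ↔ ∃ u v, HD u v ∧ π u = a ∧ π v = b)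
    (ℓH : VG → VG → ℕ)
    (hℓH : ∀ a b, ℓH a b = sInf {n : ℕ | ∃ u v, HD u v ∧ π u = a ∧ π v = b ∧ ℓHD u v = n}) :
    (∀ a b, EH a b → gdist EG ℓG a b ≤ (ℓH a b : ℝ≥0∞)) ∧
    (∀ s t : VG,
      gdistHop (unionEdge EG EH) (unionLen EG EH ℓG ℓH) β s t ≤
        (1 + ENNReal.ofReal (3 * ε)) * gdist EG ℓG s t) := by
  have hmin : ∀ u v, HD u v → ℓH (π u) (π v) ≤ ℓHD u v := by
    intro u v h
    rw [hℓH]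
    exact Nat.sInf_le ⟨u, v, h, rfl, rfl, rfl⟩
  constructor
  · intro a b hab
    obtain ⟨u, v, h, hu, hv⟩ := (hEH a b).1 hab
    have hmem := Nat.sInf_mem
      (s := {n : ℕ | ∃ u v, HD u v ∧ π u = a ∧ π v = b ∧ ℓHD u v = n}) ⟨_, u, v, h, hu, hv, rfl⟩
    rw [← hℓH] at hmem
    obtain ⟨u', v', h', hu', hv', he⟩ := hmem
    rw [← he]
    refine (hlow a b).trans (le_trans ?_ (hHD1 u' v' h'))
    exact iInf₂_le_of_le u' hu' (iInf₂_le v' hv')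
  · intro s t
    have key : ∀ a b, gdistHop (unionEdge EG EH) (unionLen EG EH ℓG ℓH) β (π a) (π b) ≤
        gdistHop (unionEdge ED HD) (unionLen ED HD ℓD ℓHD) β a b := by
      intro a b
      refine le_iInf₂ fun l hl => ?_
      obtain ⟨h1, h2⟩ := walk_map_len (unionEdge ED HD) (unionEdge EG EH)
        (unionLen ED HD ℓD ℓHD) (unionLen EG EH ℓG ℓH) π (by
          intro x y hxy
          have hH : HD x y → EH (π x) (π y) := fun h => (hEH _ _).2 ⟨x, y, h, rfl, rfl⟩
          have h3 := hmin x y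
          have h4 := hhom x y
          unfold unionEdge at *
          refine ⟨hxy.imp (fun h => (h4 h).1) hH, ?_⟩
          unfold unionLen
          clear hEH hℓH hmin hhom hHD1 hHD2 hlow hup hpos
          by_cases hE : ED x y <;> by_cases hh : HD x y <;>
            by_cases hE' : EG (π x) (π y) <;> by_cases hh' : EH (π x) (π y) <;>
            simp_all) b l a hl.1
      refine iInf₂_le_of_le (l.map π) ⟨h1, by simpa using hl.2⟩ ?_
      exact_mod_cast h2
    have h1 : gdistHop (unionEdge EG EH) (unionLen EG EH ℓG ℓH) β s t ≤
        (1 + ENNReal.ofReal ε) * gdistSet ED ℓD (π ⁻¹' {s}) (π ⁻¹' {t}) := by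
      have hne : (1 + ENNReal.ofReal ε) ≠ ⊤ := by simp
      have hne0 : (1 + ENNReal.ofReal ε) ≠ 0 := by simp
      rw [mul_comm, ← ENNReal.div_le_iff hne0 hne]
      refine le_iInf₂ fun a ha => le_iInf₂ fun b hb => ?_
      rw [ENNReal.div_le_iff hne0 hne, mul_comm]
      have ha' : π a = s := ha
      have hb' : π b = t := hb
      rw [← ha', ← hb']
      exact (key a b).trans (hHD2 a b)
    refine h1.trans ((mul_le_mul_right (hup s t) _).trans ?_)
    rw [← mul_assoc]
    refine mul_le_mul_left ?_ _
    rw [← ENNReal.ofReal_one, ← ENNReal.ofReal_add zero_le_one hε0.le,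
      ← ENNReal.ofReal_mul (by linarith), ← ENNReal.ofReal_add zero_le_one (by linarith)]
    exact ENNReal.ofReal_le_ofReal (by nlinarith)
end

section
/- Let G be a directed graph with positive integer edge lengths, let 0 < ε ≤ 1, let D be a (1+ε)-distance-preserving DAG projection onto G with map π, and let P ⊆ V(G) × V(G) be a set of demand pairs. Suppose H^D is a subgraph of D (a subset of its edges with the same lengths) such that for every (s,t) ∈ P, dist_{H^D}(π⁻¹(s), π⁻¹(t)) ≤ (1+ε)·dist_D(π⁻¹(s), π⁻¹(t)). Then the projected edge set H := {(π(u), π(v)) : (u,v) ∈ E(H^D)} is a subgraph of G (with lengths ℓ_G) satisfying dist_H(s,t) ≤ (1+3ε)·dist_G(s,t) for every (s,t) ∈ P. -/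
open scoped Classical ENNReal

/-- Walks project along a length-preserving homomorphism. -/
theorem walk_project {VG VD : Type*} (E : VD → VD → Prop) (F : VG → VG → Prop)
    (ℓD : VD → VD → ℕ) (ℓG : VG → VG → ℕ) (π : VD → VG)
    (h : ∀ x y, E x y → F (π x) (π y) ∧ ℓD x y = ℓG (π x) (π y)) (b : VD) :
    ∀ (l : List VD) (a : VD), IsWalk E a b l →
      IsWalk F (π a) (π b) (l.map π) ∧ walkLen ℓG (π a) (l.map π) = walkLen ℓD a l := by
  intro l
  induction l with
  | nil =>
    intro a ha
    have hab : a = b := ha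
    subst hab
    exact ⟨rfl, rfl⟩
  | cons v rest ih =>
    intro a ha
    obtain ⟨h1, h2⟩ := ha
    obtain ⟨h3, h4⟩ := ih v h2
    refine ⟨⟨(h a v h1).1, h3⟩, ?_⟩
    simp only [List.map_cons, walkLen, h4, (h a v h1).2]

/-- Let `D` be a `(1+ε)`-distance-preserving DAG projection
onto `G` and `P` a set of demand pairs. If `H^D` is a subgraph of `D` with
`dist_{H^D}(π⁻¹(s),π⁻¹(t)) ≤ (1+ε)·dist_D(π⁻¹(s),π⁻¹(t))` for every `(s,t) ∈ P`,
then the projected edge set `H = π(E(H^D))` is a subgraph of `G` (with lengths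
`ℓ_G`) satisfying `dist_H(s,t) ≤ (1+3ε)·dist_G(s,t)` for every `(s,t) ∈ P`. -/
theorem statement4 {VG VD : Type*} [Fintype VG] [Fintype VD]
    (EG : VG → VG → Prop) (ℓG : VG → VG → ℕ)
    (hpos : ∀ u v, EG u v → 0 < ℓG u v)
    (ε : ℝ) (hε0 : 0 < ε) (hε1 : ε ≤ 1)
    (ED : VD → VD → Prop) (ℓD : VD → VD → ℕ) (π : VD → VG)
    (hdag : IsDag ED)
    (hhom : ∀ x y, ED x y → EG (π x) (π y) ∧ ℓD x y = ℓG (π x) (π y))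
    (hlow : ∀ s t : VG, gdist EG ℓG s t ≤ gdistSet ED ℓD (π ⁻¹' {s}) (π ⁻¹' {t}))
    (hup : ∀ s t : VG, gdistSet ED ℓD (π ⁻¹' {s}) (π ⁻¹' {t}) ≤
      (1 + ENNReal.ofReal ε) * gdist EG ℓG s t)
    (P : Set (VG × VG))
    (EHD : VD → VD → Prop) (hsub : ∀ x y, EHD x y → ED x y)
    (hpres : ∀ p ∈ P, gdistSet EHD ℓD (π ⁻¹' {p.1}) (π ⁻¹' {p.2}) ≤
      (1 + ENNReal.ofReal ε) * gdistSet ED ℓD (π ⁻¹' {p.1}) (π ⁻¹' {p.2}))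
    (EH : VG → VG → Prop)
    (hEH : ∀ a b, EH a b ↔ ∃ x y, EHD x y ∧ π x = a ∧ π y = b) :
    (∀ a b, EH a b → EG a b) ∧
    (∀ p ∈ P, gdist EH ℓG p.1 p.2 ≤
      (1 + ENNReal.ofReal (3 * ε)) * gdist EG ℓG p.1 p.2) := by
  refine ⟨?_, ?_⟩
  · intro a b hab
    obtain ⟨x, y, hxy, rfl, rfl⟩ := (hEH a b).1 hab
    exact (hhom x y (hsub x y hxy)).1
  · intro p hp
    have key : gdist EH ℓG p.1 p.2 ≤ gdistSet EHD ℓD (π ⁻¹' {p.1}) (π ⁻¹' {p.2}) := by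
      unfold gdistSet
      refine le_iInf₂ fun a ha => le_iInf₂ fun b hb => ?_
      have ha' : π a = p.1 := ha
      have hb' : π b = p.2 := hb
      rw [← ha', ← hb']
      unfold gdist
      refine le_iInf₂ fun l hl => ?_
      obtain ⟨h1, h2⟩ := walk_project EHD EH ℓD ℓG π
        (fun x y hxy => ⟨(hEH _ _).2 ⟨x, y, hxy, rfl, rfl⟩, (hhom x y (hsub x y hxy)).2⟩) b l a hl
      exact (iInf₂_le (l.map π) h1).trans (by rw [h2])
    have hnum : (1 + ENNReal.ofReal ε) * (1 + ENNReal.ofReal ε)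
        ≤ 1 + ENNReal.ofReal (3 * ε) := by
      rw [← ENNReal.ofReal_one, ← ENNReal.ofReal_add zero_le_one hε0.le,
        ← ENNReal.ofReal_mul (by positivity), ← ENNReal.ofReal_add zero_le_one (by positivity)]
      apply ENNReal.ofReal_le_ofReal
      nlinarith
    calc gdist EH ℓG p.1 p.2 ≤ _ := key
      _ ≤ _ := hpres p hp
      _ ≤ (1 + ENNReal.ofReal ε) * ((1 + ENNReal.ofReal ε) * gdist EG ℓG p.1 p.2) := by
        gcongr
        exact hup _ _
      _ = ((1 + ENNReal.ofReal ε) * (1 + ENNReal.ofReal ε)) * gdist EG ℓG p.1 p.2 := by ring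
      _ ≤ _ := by gcongr
end

section
/- Let D be a finite directed acyclic graph with positive integer edge lengths whose vertices v_1, …, v_n are listed in a topological order (every edge goes from v_i to v_j with i < j), and let M be an integer with M > Σ_{e ∈ E(D)} ℓ(e). Let D' be the undirected graph on the same vertex set that has, for each directed edge (v_i, v_j) of D, an undirected edge {v_i, v_j} of length ℓ(v_i,v_j) + (j−i)·M. Then for every i < j: (1) if v_j is reachable from v_i in D, then dist_{D'}(v_i, v_j) = dist_D(v_i, v_j) + (j−i)·M; and (2) if v_j is not reachable from v_i in D, then dist_{D'}(v_i, v_j) ≥ (j−i+2)·M. -/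
open scoped Classical ENNReal

theorem walk_up {n : ℕ} (ED : Fin n → Fin n → Prop) (htopo : ∀ i j, ED i j → i < j)
    (ℓ : Fin n → Fin n → ℕ) (M : ℕ)
    (E' : Fin n → Fin n → Prop)
    (hE' : ∀ i j, E' i j ↔ (ED i j ∨ ED j i))
    (ℓ' : Fin n → Fin n → ℕ)
    (hℓ' : ∀ i j, ED i j →
      ℓ' i j = ℓ i j + ((j : ℕ) - (i : ℕ)) * M ∧
      ℓ' j i = ℓ i j + ((j : ℕ) - (i : ℕ)) * M) (t : Fin n) (l : List (Fin n)) :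
    ∀ s, IsWalk ED s t l → s ≤ t ∧ IsWalk E' s t l ∧
      walkLen ℓ' s l = walkLen ℓ s l + ((t : ℕ) - (s : ℕ)) * M := by
  induction l with
  | nil => intro s h; simp only [IsWalk] at h; subst h; simp [IsWalk, walkLen]
  | cons v r ih =>
    intro s h
    obtain ⟨h1, h2⟩ := h
    obtain ⟨a, b, c⟩ := ih v h2
    have hlt := htopo _ _ h1
    refine ⟨hlt.le.trans a, ⟨(hE' _ _).2 (Or.inl h1), b⟩, ?_⟩
    simp only [walkLen, c, (hℓ' _ _ h1).1]
    have : (t : ℕ) - s = (v - s) + (t - v) := by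
      have : (s : ℕ) < v := hlt
      have : (v : ℕ) ≤ t := a
      omega
    rw [this]; ring

theorem walk_down {n : ℕ} (ED : Fin n → Fin n → Prop) (htopo : ∀ i j, ED i j → i < j)
    (ℓ : Fin n → Fin n → ℕ) (M : ℕ)
    (E' : Fin n → Fin n → Prop)
    (hE' : ∀ i j, E' i j ↔ (ED i j ∨ ED j i))
    (ℓ' : Fin n → Fin n → ℕ)
    (hℓ' : ∀ i j, ED i j →
      ℓ' i j = ℓ i j + ((j : ℕ) - (i : ℕ)) * M ∧
      ℓ' j i = ℓ i j + ((j : ℕ) - (i : ℕ)) * M) (t : Fin n) (l : List (Fin n)) :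
    ∀ s, IsWalk E' s t l → ((t : ℤ) - (s : ℤ)) * M ≤ walkLen ℓ' s l ∧
      (IsWalk ED s t l ∨ ((t : ℤ) - (s : ℤ) + 2) * M ≤ walkLen ℓ' s l) := by
  induction l with
  | nil => intro s h; simp only [IsWalk] at h; subst h; simp [IsWalk, walkLen]
  | cons v r ih =>
    intro s h
    obtain ⟨h1, h2⟩ := h
    obtain ⟨a, b⟩ := ih v h2
    have hM0 : (0 : ℤ) ≤ M := Int.natCast_nonneg M
    simp only [walkLen, Nat.cast_add]
    rcases (hE' _ _).1 h1 with h1 | h1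
    · have hlt : (s : ℕ) < v := htopo _ _ h1
      have e : (ℓ' s v : ℤ) = ℓ s v + ((v : ℤ) - s) * M := by
        rw [(hℓ' _ _ h1).1]; push_cast [Nat.cast_sub hlt.le]; ring
      have p : (0 : ℤ) ≤ ℓ s v := Int.natCast_nonneg _
      refine ⟨by linarith, ?_⟩
      rcases b with b | b
      · exact Or.inl ⟨h1, b⟩
      · right; linarith
    · have hlt : (v : ℕ) < s := htopo _ _ h1
      have e : (ℓ' s v : ℤ) = ℓ v s + ((s : ℤ) - v) * M := by
        rw [(hℓ' _ _ h1).2]; push_cast [Nat.cast_sub hlt.le]; ring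
      have p : (0 : ℤ) ≤ ℓ v s := Int.natCast_nonneg _
      have q : (0 : ℤ) ≤ ((s : ℤ) - v - 1) * M := mul_nonneg (by omega) hM0
      exact ⟨by linarith, Or.inr (by linarith)⟩

theorem walk_total {n : ℕ} (ED : Fin n → Fin n → Prop) (htopo : ∀ i j, ED i j → i < j)
    (ℓ : Fin n → Fin n → ℕ) (t : Fin n) (l : List (Fin n)) :
    ∀ s, IsWalk ED s t l → walkLen ℓ s l ≤
      ∑ p : Fin n × Fin n, if ED p.1 p.2 ∧ s ≤ p.1 then ℓ p.1 p.2 else 0 := by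
  induction l with
  | nil => intro s h; simp [walkLen]
  | cons v r ih =>
    intro s h
    obtain ⟨h1, h2⟩ := h
    have hlt := htopo _ _ h1
    have e : ℓ s v = ∑ p : Fin n × Fin n, if p = (s, v) then ℓ p.1 p.2 else 0 := by simp
    simp only [walkLen]
    refine (Nat.add_le_add_left (ih v h2) _).trans ?_
    rw [e, ← Finset.sum_add_distrib]
    refine Finset.sum_le_sum fun p _ => ?_
    by_cases hp : p = (s, v)
    · subst hp
      simp [h1, hlt.not_ge]
    · simp only [hp, if_false, zero_add]
      by_cases hq : ED p.1 p.2 ∧ v ≤ p.1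
      · rw [if_pos hq, if_pos ⟨hq.1, hlt.le.trans hq.2⟩]
      · rw [if_neg hq]; exact Nat.zero_le _

theorem walk_reach {V : Type*} (E : V → V → Prop) (t : V) (l : List V) :
    ∀ s, IsWalk E s t l → Relation.ReflTransGen E s t := by
  induction l with
  | nil => intro s h; simp only [IsWalk] at h; subst h; exact .refl
  | cons v r ih => intro s h; exact .head h.1 (ih v h.2)

theorem reach_walk {V : Type*} (E : V → V → Prop) (s t : V)
    (h : Relation.ReflTransGen E s t) : ∃ l, IsWalk E s t l := by
  induction h using Relation.ReflTransGen.head_induction_on with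
  | refl => exact ⟨[], rfl⟩
  | head h _ ih => obtain ⟨l, hl⟩ := ih; exact ⟨_ :: l, h, hl⟩

/-- Let `D` be a DAG on vertices `0,…,n−1` in topological order
(positive integer edge lengths), and `M` exceed the total edge length. Let `D'`
be the undirected graph with, for each edge `(i,j)` of `D`, an undirected edge
`{i,j}` of length `ℓ(i,j) + (j−i)·M`. Then for `i < j`: if `j` is reachable
from `i` in `D`, `dist_{D'}(i,j) = dist_D(i,j) + (j−i)·M`; otherwise
`dist_{D'}(i,j) ≥ (j−i+2)·M`. -/
theorem statement5 (n : ℕ)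
    (ED : Fin n → Fin n → Prop) (htopo : ∀ i j, ED i j → i < j)
    (ℓ : Fin n → Fin n → ℕ) (hpos : ∀ i j, ED i j → 0 < ℓ i j)
    (M : ℕ)
    (hM : (∑ p : Fin n × Fin n, if ED p.1 p.2 then ℓ p.1 p.2 else 0) < M)
    (E' : Fin n → Fin n → Prop)
    (hE' : ∀ i j, E' i j ↔ (ED i j ∨ ED j i))
    (ℓ' : Fin n → Fin n → ℕ)
    (hℓ' : ∀ i j, ED i j →
      ℓ' i j = ℓ i j + ((j : ℕ) - (i : ℕ)) * M ∧
      ℓ' j i = ℓ i j + ((j : ℕ) - (i : ℕ)) * M) :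
    ∀ i j : Fin n, i < j →
      (Relation.ReflTransGen ED i j →
        gdist E' ℓ' i j = gdist ED ℓ i j + (((j : ℕ) - (i : ℕ)) * M : ℕ)) ∧
      (¬ Relation.ReflTransGen ED i j →
        ((((j : ℕ) - (i : ℕ) + 2) * M : ℕ) : ℝ≥0∞) ≤ gdist E' ℓ' i j) := by
  intro i j hij
  have hij' : (i : ℕ) < j := hij
  have key : ∀ l, IsWalk E' i j l → IsWalk ED i j l ∨
      ((j : ℕ) - (i : ℕ) + 2) * M ≤ walkLen ℓ' i l := by
    intro l hl
    rcases (walk_down ED htopo ℓ M E' hE' ℓ' hℓ' j l i hl).2 with h | h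
    · exact Or.inl h
    · right
      zify [hij'.le]
      exact h
  refine ⟨fun hr => le_antisymm ?_ ?_, fun hr => ?_⟩
  · unfold gdist
    rw [ENNReal.iInf_add]
    refine le_iInf fun l => ?_
    rw [ENNReal.iInf_add]
    refine le_iInf fun hl => ?_
    obtain ⟨-, b, c⟩ := walk_up ED htopo ℓ M E' hE' ℓ' hℓ' j l i hl
    refine (iInf₂_le l b).trans ?_
    rw [c, Nat.cast_add]
  · refine le_iInf₂ fun l hl => ?_
    rcases key l hl with h | h
    · obtain ⟨-, b, c⟩ := walk_up ED htopo ℓ M E' hE' ℓ' hℓ' j l i h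
      rw [c, Nat.cast_add]
      gcongr
      exact iInf₂_le l h
    · obtain ⟨k, hk⟩ := reach_walk ED i j hr
      have h1 := walk_total ED htopo ℓ j k i hk
      have h2 : (∑ p : Fin n × Fin n, if ED p.1 p.2 ∧ i ≤ p.1 then ℓ p.1 p.2 else 0) ≤
          ∑ p : Fin n × Fin n, if ED p.1 p.2 then ℓ p.1 p.2 else 0 := by
        refine Finset.sum_le_sum fun p _ => ?_
        by_cases hq : ED p.1 p.2 ∧ i ≤ p.1
        · rw [if_pos hq, if_pos hq.1]
        · rw [if_neg hq]; exact Nat.zero_le _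
      have h3 : gdist ED ℓ i j ≤ (walkLen ℓ i k : ℝ≥0∞) := iInf₂_le k hk
      refine (add_le_add_left h3 _).trans ?_
      rw [← Nat.cast_add]
      refine Nat.cast_le.2 (le_trans ?_ h)
      rw [add_mul]
      omega
  · refine le_iInf₂ fun l hl => ?_
    rcases key l hl with h | h
    · exact absurd (walk_reach ED j l i h) hr
    · exact Nat.cast_le.2 h
end
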